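/- Let S be a K-algebra with a pseudo-degree function χ, and let a ∈ S with m = χ(a) > 0 be such that C_S(a) satisfies condition D(ℓ) for some positive integer ℓ. Then C_S(a) is a free K[a]-module of rank at most ℓ·m. -/

import Mathlib

open Polynomial

/-- A pseudo-degree function on a ring `S`: a valuation-like map
`χ : S → ℤ ∪ {-∞}` with `χ a = -∞ ↔ a = 0`, `χ (ab) = χ a + χ b` and
`χ (a+b) ≤ max (χ a) (χ b)`. -/
structure IsPseudoDegree {S : Type*} [Ring S] (χ : S → WithBot ℤ) : Prop where
  eq_bot_iff : ∀ a : S, χ a = ⊥ ↔ a = 0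
  map_mul : ∀ a b : S, χ (a * b) = χ a + χ b
  add_le : ∀ a b : S, χ (a + b) ≤ max (χ a) (χ b)

/-- Condition `D(ℓ)` for a subalgebra `B` of `S`: every nonzero element of `B`
has `χ`-value `≥ 0`, and any `ℓ+1` elements of `B` all mapped to the same
integer by `χ` admit a nontrivial `K`-linear combination of strictly smaller
`χ`-value. -/
def CondD {K S : Type*} [Field K] [Ring S] [Algebra K S] (χ : S → WithBot ℤ)
    (B : Subalgebra K S) (ℓ : ℕ) : Prop :=
  (∀ b ∈ B, b ≠ 0 → 0 ≤ χ b) ∧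
  ∀ b : Fin (ℓ + 1) → S, (∀ i, b i ∈ B) → (∀ i, χ (b i) = χ (b 0)) → χ (b 0) ≠ ⊥ →
    ∃ α : Fin (ℓ + 1) → K, α ≠ 0 ∧ χ (∑ i, α i • b i) < χ (b 0)


namespace PD

variable {K S : Type*} [Field K] [Ring S] [Algebra K S]

lemma rank_step (V1 V2 : Submodule K S) (h12 : V1 ≤ V2) (l : ℕ)
    (h : ∀ v : Fin (l + 1) → S, (∀ i, v i ∈ V2) →
      ∃ α : Fin (l + 1) → K, α ≠ 0 ∧ ∑ i, α i • v i ∈ V1) :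
    Module.rank K V2 ≤ Module.rank K V1 + l := by
  let N : Submodule K V2 := V1.comap V2.subtype
  have e : Module.rank K N = Module.rank K V1 :=
    (Submodule.comapSubtypeEquivOfLe h12).rank_eq
  rw [← e, ← Submodule.rank_quotient_add_rank N, add_comm]
  gcongr
  apply rank_le
  intro s hs
  by_contra! hcard
  obtain ⟨t, hts, ht⟩ := Finset.exists_subset_card_eq (show l + 1 ≤ s.card from hcard)
  let f := t.equivFinOfCardEq ht
  have hli : LinearIndependent K (fun i : Fin (l + 1) => ((f.symm i : t) : V2 ⧸ N)) := by
    have := hs.comp (fun i : Fin (l + 1) => (⟨(f.symm i : t), hts (f.symm i).2⟩ : s)) (by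
      intro i j hij
      simpa [Subtype.ext_iff] using hij)
    exact this
  choose g hg using fun i : Fin (l + 1) => N.mkQ_surjective (f.symm i : t)
  obtain ⟨α, hα, hm⟩ := h (fun i => (g i : S)) (fun i => (g i).2)
  apply hα
  have : ∑ i, α i • g i ∈ N := by
    simpa [N] using hm
  have h0 : ∑ i, α i • ((f.symm i : t) : V2 ⧸ N) = 0 := by
    have h1 := (Submodule.Quotient.mk_eq_zero N).2 this
    rw [← Submodule.mkQ_apply, map_sum] at h1
    simpa only [map_smul, hg] using h1
  funext i
  exact Fintype.linearIndependent_iff.1 hli α h0 i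

variable {χ : S → WithBot ℤ}

lemma chi_zero (hχ : IsPseudoDegree χ) : χ 0 = ⊥ := (hχ.eq_bot_iff 0).2 rfl

lemma chi_one (hχ : IsPseudoDegree χ) (h : (1 : S) ≠ 0) : χ 1 = 0 := by
  have h1 := hχ.map_mul 1 1
  have h2 : χ 1 ≠ ⊥ := fun h' => h ((hχ.eq_bot_iff 1).1 h')
  obtain ⟨z, hz⟩ := WithBot.ne_bot_iff_exists.1 h2
  rw [mul_one, ← hz] at h1
  rw [← hz]
  norm_cast at h1 ⊢
  omega

lemma mul_eq_zero' (hχ : IsPseudoDegree χ) {x y : S} (h : x * y = 0) : x = 0 ∨ y = 0 := by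
  rw [← hχ.eq_bot_iff, hχ.map_mul, WithBot.add_eq_bot] at h
  rwa [hχ.eq_bot_iff, hχ.eq_bot_iff] at h

lemma chi_alg (hχ : IsPseudoDegree χ) (B : Subalgebra K S)
    (hB : ∀ b ∈ B, b ≠ 0 → 0 ≤ χ b) (r : K) : χ (algebraMap K S r) ≤ 0 := by
  by_cases h1 : (1 : S) = 0
  · have : algebraMap K S r = 0 := by rw [← mul_one (algebraMap K S r), h1, mul_zero]
    rw [this, chi_zero hχ]; exact bot_le
  by_cases hr : r = 0
  · rw [hr, map_zero, chi_zero hχ]; exact bot_le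
  have hp : algebraMap K S r * algebraMap K S r⁻¹ = 1 := by
    rw [← map_mul, mul_inv_cancel₀ hr, map_one]
  have e := hχ.map_mul (algebraMap K S r) (algebraMap K S r⁻¹)
  rw [hp, chi_one hχ h1] at e
  have h3 := hB _ (B.algebraMap_mem r⁻¹) (by
    intro h; rw [h, mul_zero] at hp; exact h1 hp.symm)
  calc χ (algebraMap K S r) = χ (algebraMap K S r) + 0 := (add_zero _).symm
    _ ≤ χ (algebraMap K S r) + χ (algebraMap K S r⁻¹) := by gcongr
    _ = 0 := e.symm

lemma chi_smul (hχ : IsPseudoDegree χ) (B : Subalgebra K S)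
    (hB : ∀ b ∈ B, b ≠ 0 → 0 ≤ χ b) (r : K) (x : S) : χ (r • x) ≤ χ x := by
  rw [Algebra.smul_def, hχ.map_mul]
  calc _ ≤ 0 + χ x := by gcongr; exact chi_alg hχ B hB r
    _ = χ x := zero_add _

/-- The elements of `B` of `χ`-value below `n`. -/
def F (hχ : IsPseudoDegree χ) (B : Subalgebra K S)
    (hB : ∀ b ∈ B, b ≠ 0 → 0 ≤ χ b) (n : ℕ) : Submodule K S where
  carrier := {x | x ∈ B ∧ χ x < ((n : ℤ) : WithBot ℤ)}
  zero_mem' := ⟨B.zero_mem, by rw [chi_zero hχ]; exact WithBot.bot_lt_coe _⟩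
  add_mem' := fun ⟨h1, h2⟩ ⟨h3, h4⟩ =>
    ⟨B.add_mem h1 h3, (hχ.add_le _ _).trans_lt (max_lt h2 h4)⟩
  smul_mem' := fun r x ⟨h1, h2⟩ => ⟨B.smul_mem h1 r, (chi_smul hχ B hB r x).trans_lt h2⟩

lemma mem_F (hχ : IsPseudoDegree χ) (B : Subalgebra K S)
    (hB : ∀ b ∈ B, b ≠ 0 → 0 ≤ χ b) (n : ℕ) (x : S) :
    x ∈ F hχ B hB n ↔ x ∈ B ∧ χ x < ((n : ℤ) : WithBot ℤ) := Iff.rfl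

lemma F_mono (hχ : IsPseudoDegree χ) (B : Subalgebra K S)
    (hB : ∀ b ∈ B, b ≠ 0 → 0 ≤ χ b) {n k : ℕ} (h : n ≤ k) : F hχ B hB n ≤ F hχ B hB k :=
  fun _ hx => ⟨hx.1, hx.2.trans_le (by exact_mod_cast h)⟩

lemma F_zero (hχ : IsPseudoDegree χ) (B : Subalgebra K S)
    (hB : ∀ b ∈ B, b ≠ 0 → 0 ≤ χ b) : F hχ B hB 0 = ⊥ := by
  rw [eq_bot_iff]
  intro x hx
  by_contra h
  exact absurd (hB x hx.1 h) (not_le.2 hx.2)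

lemma lt_succ_iff (x : WithBot ℤ) (n : ℕ) :
    x < (((n + 1 : ℕ) : ℤ) : WithBot ℤ) ↔ x ≤ ((n : ℤ) : WithBot ℤ) := by
  induction x with
  | bot => simp
  | coe z =>
    norm_cast
    push_cast
    omega

lemma exists_mem_F (hχ : IsPseudoDegree χ) (B : Subalgebra K S)
    (hB : ∀ b ∈ B, b ≠ 0 → 0 ≤ χ b) (x : S) (hx : x ∈ B) : ∃ n, x ∈ F hχ B hB n := by
  rcases h : χ x with _ | z
  · refine ⟨0, hx, ?_⟩
    rw [h]; exact WithBot.bot_lt_coe _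
  · refine ⟨z.toNat + 1, hx, ?_⟩
    rw [h]
    refine WithBot.coe_lt_coe.2 ?_
    push_cast
    omega

lemma rank_F_succ (hχ : IsPseudoDegree χ) (B : Subalgebra K S) (l : ℕ)
    (hD : CondD χ B l) (n : ℕ) :
    Module.rank K (F hχ B hD.1 (n + 1)) ≤ Module.rank K (F hχ B hD.1 n) + l := by
  apply rank_step _ _ (F_mono hχ B hD.1 (Nat.le_succ n))
  intro v hv
  by_cases h : ∃ i, v i ∈ F hχ B hD.1 n
  · obtain ⟨i, hi⟩ := h
    refine ⟨Pi.single i 1, by simp, ?_⟩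
    rw [Finset.sum_eq_single i]
    · simpa using hi
    · intro j _ hj; simp [hj]
    · simp
  · push Not at h
    have he : ∀ i, χ (v i) = ((n : ℤ) : WithBot ℤ) := by
      intro i
      refine le_antisymm ((lt_succ_iff _ _).1 (hv i).2) ?_
      by_contra hlt
      exact h i ⟨(hv i).1, not_le.1 hlt⟩
    obtain ⟨α, h0, h1⟩ := hD.2 v (fun i => (hv i).1) (fun i => by rw [he, he])
      (by rw [he]; exact WithBot.coe_ne_bot)
    refine ⟨α, h0, B.sum_mem fun i _ => B.smul_mem (hv i).1 _, ?_⟩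
    rwa [he] at h1

lemma finite_F (hχ : IsPseudoDegree χ) (B : Subalgebra K S) (l : ℕ)
    (hD : CondD χ B l) (n : ℕ) : Module.Finite K (F hχ B hD.1 n) := by
  rw [← Module.rank_lt_aleph0_iff]
  induction n with
  | zero => rw [F_zero, rank_bot]; exact Cardinal.aleph0_pos
  | succ n ih =>
    exact (rank_F_succ hχ B l hD n).trans_lt
      (Cardinal.add_lt_aleph0 ih Cardinal.natCast_lt_aleph0)

lemma finrank_F (hχ : IsPseudoDegree χ) (B : Subalgebra K S) (l : ℕ)
    (hD : CondD χ B l) (n k : ℕ) :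
    Module.finrank K (F hχ B hD.1 (n + k)) ≤ Module.finrank K (F hχ B hD.1 n) + l * k := by
  induction k with
  | zero => simp
  | succ k ih =>
    have h := rank_F_succ hχ B l hD (n + k)
    haveI := finite_F hχ B l hD (n + k)
    haveI := finite_F hχ B l hD (n + k + 1)
    rw [← Module.finrank_eq_rank, ← Module.finrank_eq_rank] at h
    norm_cast at h
    rw [← add_assoc, mul_add]
    omega

/-- Independence modulo `aB`. -/
def Ind (a : S) (B : Subalgebra K S) (k : ℕ) (c : Fin k → S) : Prop :=
  (∀ i, c i ∈ B) ∧ ∀ r : Fin k → K, ∀ x ∈ B, ∑ i, r i • c i = a * x → r = 0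

lemma exists_common_F (hχ : IsPseudoDegree χ) (B : Subalgebra K S)
    (hB : ∀ b ∈ B, b ≠ 0 → 0 ≤ χ b) {k : ℕ} (c : Fin k → S) (hc : ∀ i, c i ∈ B) :
    ∃ n, ∀ i, c i ∈ F hχ B hB n := by
  choose f hf using fun i => exists_mem_F hχ B hB (c i) (hc i)
  exact ⟨Finset.univ.sup f, fun i => F_mono hχ B hB (Finset.le_sup (Finset.mem_univ i)) (hf i)⟩

lemma ind_le (hχ : IsPseudoDegree χ) (B : Subalgebra K S) (l : ℕ)
    (hD : CondD χ B l) (a : S) (ha : a ∈ B) (m : ℕ)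
    (hχa : χ a = ((m : ℤ) : WithBot ℤ)) (k : ℕ) (c : Fin k → S)
    (hc : Ind a B k c) : k ≤ l * m := by
  have ha0 : a ≠ 0 := by
    intro h; rw [h, chi_zero hχ] at hχa; exact WithBot.bot_ne_coe hχa
  obtain ⟨n, hn⟩ := exists_common_F hχ B hD.1 c hc.1
  let g : ((Fin k → K) × F hχ B hD.1 n) →ₗ[K] S :=
    (Fintype.linearCombination K c).coprod
      ((LinearMap.mulLeft K a).comp (F hχ B hD.1 n).subtype)
  have hg : ∀ p, g p = ∑ i, p.1 i • c i + a * (p.2 : S) := by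
    intro p
    simp [g, Fintype.linearCombination_apply]
  have hmem : ∀ p, g p ∈ F hχ B hD.1 (n + m) := by
    intro p
    rw [hg]
    refine Submodule.add_mem _ ?_ ?_
    · exact Submodule.sum_mem _ fun i _ => Submodule.smul_mem _ _
        (F_mono hχ B hD.1 (Nat.le_add_right n m) (hn i))
    · refine ⟨B.mul_mem ha p.2.2.1, ?_⟩
      have := p.2.2.2
      rw [hχ.map_mul, hχa]
      generalize χ (p.2 : S) = z at this
      induction z with
      | bot => simp
      | coe z => norm_cast at this ⊢; push_cast; omega
  let g' := g.codRestrict _ hmem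
  have hinj : Function.Injective g' := by
    rw [← LinearMap.ker_eq_bot, LinearMap.ker_codRestrict, LinearMap.ker_eq_bot']
    intro p hp
    rw [hg] at hp
    have h1 : p.1 = 0 := hc.2 p.1 (-(p.2 : S)) (B.neg_mem p.2.2.1) (by
      rw [mul_neg]; exact eq_neg_of_add_eq_zero_left hp)
    rw [h1] at hp
    simp only [Pi.zero_apply, zero_smul, Finset.sum_const_zero, zero_add] at hp
    have h2 := (mul_eq_zero' hχ hp).resolve_left ha0
    exact Prod.ext h1 (Subtype.ext h2)
  haveI := finite_F hχ B l hD n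
  haveI := finite_F hχ B l hD (n + m)
  have h1 := LinearMap.finrank_le_finrank_of_injective hinj
  rw [Module.finrank_prod, Module.finrank_fin_fun] at h1
  have h2 := finrank_F hχ B l hD n m
  omega

lemma exists_N (hχ : IsPseudoDegree χ) (B : Subalgebra K S) (l : ℕ)
    (hD : CondD χ B l) (a : S) (ha : a ∈ B) (m : ℕ)
    (hχa : χ a = ((m : ℤ) : WithBot ℤ)) :
    ∃ N, ∀ x ∈ B, ∃ f ∈ F hχ B hD.1 N, ∃ y ∈ B, x = f + a * y := by
  classical
  let P : ℕ → Prop := fun k => ∃ c : Fin k → S, Ind a B k c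
  have hP0 : P 0 := ⟨Fin.elim0, fun i => i.elim0, fun r _ _ _ => Subsingleton.elim _ _⟩
  have hP := Nat.findGreatest_spec (P := P) (Nat.zero_le (l * m)) hP0
  have hmax : ¬ P (Nat.findGreatest P (l * m) + 1) := by
    intro h
    have h1 : Nat.findGreatest P (l * m) + 1 ≤ l * m := by
      obtain ⟨c, hc⟩ := h
      exact ind_le hχ B l hD a ha m hχa _ c hc
    have := Nat.le_findGreatest h1 h
    omega
  generalize Nat.findGreatest P (l * m) = k at hP hmax
  obtain ⟨c, hc⟩ := hP
  obtain ⟨N, hN⟩ := exists_common_F hχ B hD.1 c hc.1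
  refine ⟨N, fun x hx => ?_⟩
  by_contra hcon
  apply hmax
  refine ⟨Fin.cons x c, ?_, ?_⟩
  · intro i
    refine Fin.cases ?_ (fun j => ?_) i
    · simpa using hx
    · simpa using hc.1 j
  · intro r y hy hr
    rw [Fin.sum_univ_succ] at hr
    simp only [Fin.cons_zero, Fin.cons_succ] at hr
    by_cases h0 : r 0 = 0
    · rw [h0, zero_smul, zero_add] at hr
      have := hc.2 (fun i => r i.succ) y hy hr
      funext i
      refine Fin.cases h0 (fun j => ?_) i
      exact congrFun this j
    · exfalso
      apply hcon
      refine ⟨-((r 0)⁻¹ • ∑ i : Fin k, r i.succ • c i), ?_, (r 0)⁻¹ • y, B.smul_mem hy _, ?_⟩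
      · exact Submodule.neg_mem _ (Submodule.smul_mem _ _ (Submodule.sum_mem _ fun i _ =>
          Submodule.smul_mem _ _ (hN i)))
      · rw [mul_smul_comm, ← hr, smul_add, smul_smul, inv_mul_cancel₀ h0, one_smul]
        abel

lemma aeval_inj (hχ : IsPseudoDegree χ) (B : Subalgebra K S)
    (hB : ∀ b ∈ B, b ≠ 0 → 0 ≤ χ b) (a : S) (ha : a ∈ B) (m : ℕ) (hm : 0 < m)
    (hχa : χ a = ((m : ℤ) : WithBot ℤ)) (n : ℕ) :
    ∀ p : K[X], p.natDegree ≤ n → aeval a p = 0 → p = 0 := by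
  have ha0 : a ≠ 0 := by
    intro h; rw [h, chi_zero hχ] at hχa; exact WithBot.bot_ne_coe hχa
  have hinj : ∀ r : K, algebraMap K S r = 0 → r = 0 := by
    intro r hr
    by_contra h
    apply ha0
    have : r⁻¹ • (r • a) = a := by rw [smul_smul, inv_mul_cancel₀ h, one_smul]
    rw [← this, Algebra.smul_def r, hr, zero_mul, smul_zero]
  induction n with
  | zero =>
    intro p hp h
    rw [eq_C_of_natDegree_le_zero hp, aeval_C] at h
    rw [eq_C_of_natDegree_le_zero hp, hinj _ h, C_0]
  | succ n ih =>
    intro p hp h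
    have hpe := p.X_mul_divX_add
    rw [← hpe, map_add, map_mul, aeval_X, aeval_C] at h
    have hq : aeval a p.divX = 0 := by
      by_contra hq
      have h1 := hB _ (aeval_mem_adjoin_singleton K a |> fun h =>
        (Algebra.adjoin_le (Set.singleton_subset_iff.2 ha)) h : aeval a p.divX ∈ B) hq
      have h2 : a * aeval a p.divX = algebraMap K S (-p.coeff 0) := by
        rw [map_neg]; exact eq_neg_of_add_eq_zero_left h
      have h3 := chi_alg hχ B hB (-p.coeff 0)
      rw [← h2, hχ.map_mul, hχa] at h3
      generalize χ (aeval a p.divX) = z at h1 h3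
      induction z with
      | bot => simp at h1
      | coe z => norm_cast at h1 h3; omega
    have h4 : p.divX = 0 := ih _ (by rw [natDegree_divX_eq_natDegree_tsub_one]; omega) hq
    rw [hq, mul_zero, zero_add] at h
    rw [← hpe, h4, hinj _ h]; simp

end PD

theorem stmt4 {K S : Type*} [Field K] [Ring S] [Algebra K S]
    (χ : S → WithBot ℤ) (hχ : IsPseudoDegree χ)
    (a : S) (m : ℕ) (hm : 0 < m) (hχa : χ a = ((m : ℤ) : WithBot ℤ))
    (ℓ : ℕ) (hℓ : 0 < ℓ) (hD : CondD χ (Subalgebra.centralizer K {a}) ℓ) :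
    ∃ k : ℕ, k ≤ ℓ * m ∧ ∃ b : Fin k → S,
      (∀ i, b i ∈ Subalgebra.centralizer K {a}) ∧
      (∀ c ∈ Subalgebra.centralizer K {a}, ∃ φ : Fin k → Polynomial K,
        c = ∑ i, Polynomial.aeval a (φ i) * b i) ∧
      (∀ φ : Fin k → Polynomial K,
        ∑ i, Polynomial.aeval a (φ i) * b i = 0 → ∀ i, φ i = 0) := by
  have ha : a ∈ Subalgebra.centralizer K {a} := by
    rw [Subalgebra.mem_centralizer_iff]
    intro g hg
    rw [Set.mem_singleton_iff.1 hg]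
  generalize Subalgebra.centralizer K {a} = B at hD ha
  have haev : ∀ p : K[X], aeval a p ∈ B := fun p =>
    Algebra.adjoin_le (Set.singleton_subset_iff.2 ha) (aeval_mem_adjoin_singleton K a)
  letI : Module K[X] S := Module.compHom S (aeval a : K[X] →ₐ[K] S).toRingHom
  have hsm : ∀ (p : K[X]) (x : S), p • x = aeval a p * x := fun _ _ => rfl
  let M : Submodule K[X] S :=
    { carrier := B
      zero_mem' := B.zero_mem
      add_mem' := B.add_mem
      smul_mem' := fun p x hx => B.mul_mem (haev p) hx }
  have hMB : ∀ x, x ∈ M ↔ x ∈ B := fun _ => Iff.rfl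
  have hfg : M.FG := by
    obtain ⟨N, hN⟩ := PD.exists_N hχ B ℓ hD a ha m hχa
    haveI := PD.finite_F hχ B ℓ hD N
    obtain ⟨s, hs⟩ := (Module.Finite.iff_fg (N := PD.F hχ B hD.1 N)).1 inferInstance
    refine ⟨s, le_antisymm ?_ ?_⟩
    · rw [Submodule.span_le]
      intro x hx
      have : x ∈ PD.F hχ B hD.1 N := hs ▸ Submodule.subset_span hx
      exact this.1
    · have hF : ∀ x ∈ PD.F hχ B hD.1 N, x ∈ Submodule.span K[X] (s : Set S) := by
        intro x hx
        rw [← hs] at hx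
        induction hx using Submodule.span_induction with
        | mem x h => exact Submodule.subset_span h
        | zero => exact Submodule.zero_mem _
        | add x y _ _ h1 h2 => exact Submodule.add_mem _ h1 h2
        | smul r x _ h =>
          have := Submodule.smul_mem _ (C r) h
          rwa [hsm, aeval_C, ← Algebra.smul_def] at this
      have key : ∀ n, ∀ x ∈ PD.F hχ B hD.1 n, x ∈ Submodule.span K[X] (s : Set S) := by
        intro n
        induction n with
        | zero =>
          intro x hx
          rw [PD.F_zero] at hx
          rw [(Submodule.mem_bot K).1 hx]
          exact Submodule.zero_mem _
        | succ n ih =>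
          intro x hx
          by_cases hn : n + 1 ≤ N
          · exact hF x (PD.F_mono hχ B hD.1 hn hx)
          obtain ⟨f, hf, y, hy, rfl⟩ := hN x hx.1
          refine Submodule.add_mem _ (hF f hf) ?_
          have hay : a * y ∈ PD.F hχ B hD.1 (n + 1) := by
            have := Submodule.sub_mem _ hx (PD.F_mono hχ B hD.1 (by omega : N ≤ n + 1) hf)
            simpa using this
          have hy' : y ∈ PD.F hχ B hD.1 n := by
            refine ⟨hy, ?_⟩
            have h1 := hay.2
            rw [hχ.map_mul, hχa] at h1
            generalize χ y = z at h1
            induction z with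
            | bot => exact WithBot.bot_lt_coe _
            | coe z => norm_cast at h1 ⊢; push_cast at h1; omega
          have := Submodule.smul_mem _ (X : K[X]) (ih y hy')
          rwa [hsm, aeval_X] at this
      intro x hx
      obtain ⟨n, hn⟩ := PD.exists_mem_F hχ B hD.1 x hx
      exact key n x hn
  haveI : Module.Finite K[X] M := Module.Finite.iff_fg.2 hfg
  haveI : Module.IsTorsionFree K[X] M := by
    refine Module.IsTorsionFree.of_smul_eq_zero ?_
    intro p x hpx
    have h1 : aeval a p * (x : S) = 0 := by
      rw [← hsm]; exact congrArg Subtype.val hpx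
    rcases PD.mul_eq_zero' hχ h1 with h | h
    · exact Or.inl (PD.aeval_inj hχ B hD.1 a ha m hm hχa _ p le_rfl h)
    · exact Or.inr (Subtype.ext h)
  haveI : Module.Free K[X] M := inferInstance
  let b := Module.finBasis K[X] M
  have hli : ∀ φ : Fin (Module.finrank K[X] M) → K[X],
      ∑ i, aeval a (φ i) * (b i : S) = 0 → ∀ i, φ i = 0 := by
    intro φ h
    refine Fintype.linearIndependent_iff.1 b.linearIndependent φ ?_
    apply Subtype.ext
    rw [Submodule.coe_sum]
    exact h
  have hspan : ∀ c ∈ B, ∃ φ : Fin (Module.finrank K[X] M) → K[X],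
      c = ∑ i, aeval a (φ i) * (b i : S) := by
    intro c hc
    refine ⟨fun i => b.repr ⟨c, hc⟩ i, ?_⟩
    have := congrArg Subtype.val (b.sum_repr ⟨c, hc⟩)
    rw [Submodule.coe_sum] at this
    exact this.symm
  refine ⟨Module.finrank K[X] M, ?_, fun i => (b i : S), fun i => (b i).2, hspan, hli⟩
  refine PD.ind_le hχ B ℓ hD a ha m hχa _ (fun i => (b i : S)) ⟨fun i => (b i).2, ?_⟩
  intro r x hx hr
  obtain ⟨φ, rfl⟩ := hspan x hx
  have h0 := hli (fun i => C (r i) - X * φ i) (by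
    simp only [map_sub, map_mul, aeval_C, aeval_X, sub_mul, Finset.sum_sub_distrib,
      ← Algebra.smul_def, mul_assoc, ← Finset.mul_sum]
    rw [hr, sub_self])
  funext i
  have := congrArg (fun p => coeff p 0) (h0 i)
  simpa using this
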